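/- Let (Ω, ℱ, P) be a probability space, K and L positive integers, ỹ : Ω → EuclideanSpace ℝ (Fin L) measurable with every component ỹ_l(ω) ∈ [0,1], a : Ω → Fin K measurable, and y : Ω → Finset (Fin L) measurable. Let y_adv be a nonempty Finset of Fin L with P({a = k} ∩ {y = y_adv}) > 0 for every k ∈ Fin K. For γ > 0 set s_γ(ω) = exp(γ·(Jac(y(ω), y_adv) − 1)), and let ℓ(γ) be the s_γ-SimFair violation Σ_{k} ‖ (∫ s_γ • ỹ dP)/(∫ s_γ dP) − (∫ 1{a = k}·s_γ • ỹ dP)/(∫ 1{a = k}·s_γ dP) ‖. If there exists a sequence γ_n → ∞ with ℓ(γ_n) = 0 for all n, then the Equalized Opportunity violation is zero: for every k ∈ Fin K, (∫ 1{y = y_adv} • ỹ dP)/P(y = y_adv) = (∫ 1{a = k}·1{y = y_adv} • ỹ dP)/P({a = k} ∩ {y = y_adv}). -/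

import Mathlib

open MeasureTheory

/-- The Jaccard score between two finsets with nonempty union. -/
noncomputable def jaccard {α : Type*} [DecidableEq α] (A B : Finset α) : ℝ :=
  ((A ∩ B).card : ℝ) / ((A ∪ B).card : ℝ)

/-- The similarity `s_γ(A, B) = exp(γ·(Jac(A, B) − 1))`. -/
noncomputable def simil {α : Type*} [DecidableEq α] (γ : ℝ) (A B : Finset α) : ℝ :=
  Real.exp (γ * (jaccard A B - 1))

/-- The `s`-weighted fairness violation
`Σ_k ‖ (∫ s • ytil dP)/(∫ s dP) − (∫ 1{a = k}·s • ytil dP)/(∫ 1{a = k}·s dP) ‖`. -/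
noncomputable def fairViolation {Ω : Type*} [MeasurableSpace Ω] (P : Measure Ω)
    {K L : ℕ} (ytil : Ω → EuclideanSpace ℝ (Fin L)) (a : Ω → Fin K) (s : Ω → ℝ) : ℝ :=
  ∑ k : Fin K,
    ‖(∫ ω, s ω ∂P)⁻¹ • (∫ ω, s ω • ytil ω ∂P)
      - (∫ ω in {ω | a ω = k}, s ω ∂P)⁻¹ • (∫ ω in {ω | a ω = k}, s ω • ytil ω ∂P)‖

open Filter Topology

theorem jaccard_self {α : Type*} [DecidableEq α] {A : Finset α} (hA : A.Nonempty) :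
    jaccard A A = 1 := by
  have : (A.card : ℝ) ≠ 0 := by exact_mod_cast hA.card_pos.ne'
  simp [jaccard, this]

theorem jaccard_le_one {α : Type*} [DecidableEq α] (A B : Finset α) : jaccard A B ≤ 1 :=
  div_le_one_of_le₀ (by exact_mod_cast Finset.card_le_card Finset.inter_subset_union)
    (Nat.cast_nonneg _)

theorem jaccard_lt_one {α : Type*} [DecidableEq α] {A B : Finset α} (h : A ≠ B) :
    jaccard A B < 1 := by
  have hlt : (A ∩ B).card < (A ∪ B).card := by
    refine Finset.card_lt_card (Finset.inter_subset_union.ssubset_of_ne fun e => h ?_)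
    exact inf_eq_sup.mp e
  have hpos : (0 : ℝ) < (A ∪ B).card := by exact_mod_cast (Nat.zero_le _).trans_lt hlt
  rw [jaccard, div_lt_one hpos]
  exact_mod_cast hlt

theorem simil_self {α : Type*} [DecidableEq α] {A : Finset α} (hA : A.Nonempty) (γ : ℝ) :
    simil γ A A = 1 := by
  simp [simil, jaccard_self hA]

theorem simil_nonneg {α : Type*} [DecidableEq α] (γ : ℝ) (A B : Finset α) : 0 ≤ simil γ A B :=
  (Real.exp_pos _).le

theorem simil_le_one {α : Type*} [DecidableEq α] {γ : ℝ} (hγ : 0 ≤ γ) (A B : Finset α) :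
    simil γ A B ≤ 1 :=
  Real.exp_le_one_iff.mpr
    (mul_nonpos_of_nonneg_of_nonpos hγ (sub_nonpos.mpr (jaccard_le_one A B)))

theorem tendsto_simil_of_ne {α : Type*} [DecidableEq α] {A B : Finset α} (h : A ≠ B) :
    Tendsto (fun γ => simil γ A B) atTop (𝓝 0) :=
  Real.tendsto_exp_atBot.comp
    (tendsto_id.atTop_mul_const_of_neg (sub_neg.mpr (jaccard_lt_one h)))

theorem measurable_comp_of_countable {Ω α β : Type*} [MeasurableSpace Ω] [MeasurableSpace β]
    [Countable α] {y : Ω → α} (hy : ∀ S, MeasurableSet {ω | y ω = S}) (g : α → β) :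
    Measurable fun ω => g (y ω) := by
  let _ : MeasurableSpace α := ⊤
  exact (measurable_from_top (f := g)).comp (measurable_to_countable' hy)

/-- As the sharpness grows, integration against the similarity weight concentrates on the event
where the label set equals the advantaged one. -/
theorem tendsto_integral_simil_smul {Ω α E : Type*} [MeasurableSpace Ω] [DecidableEq α]
    [Countable α] [NormedAddCommGroup E] [NormedSpace ℝ E] {μ : Measure Ω}
    {y : Ω → Finset α} (hy : ∀ S, MeasurableSet {ω | y ω = S})
    {B : Finset α} (hB : B.Nonempty) {f : Ω → E} (hf : Integrable f μ)
    {γ : ℕ → ℝ} (hγ : Tendsto γ atTop atTop) :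
    Tendsto (fun n => ∫ ω, simil (γ n) (y ω) B • f ω ∂μ) atTop
      (𝓝 (∫ ω in {ω | y ω = B}, f ω ∂μ)) := by
  rw [← integral_indicator (hy B)]
  refine tendsto_integral_filter_of_dominated_convergence (fun ω => ‖f ω‖) ?_ ?_ hf.norm ?_
  · exact .of_forall fun n =>
      (measurable_comp_of_countable hy fun S => simil (γ n) S B).aestronglyMeasurable.smul hf.1
  · filter_upwards [hγ.eventually_ge_atTop 0] with n hn
    refine .of_forall fun ω => ?_
    rw [norm_smul, Real.norm_of_nonneg (simil_nonneg _ _ _)]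
    exact mul_le_of_le_one_left (norm_nonneg _) (simil_le_one hn _ _)
  · refine .of_forall fun ω => ?_
    by_cases h : y ω = B
    · simp [h, simil_self hB]
    · simpa [h] using ((tendsto_simil_of_ne h).comp hγ).smul_const (f ω)

/-- The similarity-weighted average converges to the average over the event where the label set
equals the advantaged one. -/
theorem tendsto_inv_integral_simil_smul {Ω α E : Type*} [MeasurableSpace Ω] [DecidableEq α]
    [Countable α] [NormedAddCommGroup E] [NormedSpace ℝ E] {μ : Measure Ω} [IsFiniteMeasure μ]
    {y : Ω → Finset α} (hy : ∀ S, MeasurableSet {ω | y ω = S})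
    {B : Finset α} (hB : B.Nonempty) (hpos : μ {ω | y ω = B} ≠ 0)
    {f : Ω → E} (hf : Integrable f μ) {γ : ℕ → ℝ} (hγ : Tendsto γ atTop atTop) :
    Tendsto (fun n => (∫ ω, simil (γ n) (y ω) B ∂μ)⁻¹ • ∫ ω, simil (γ n) (y ω) B • f ω ∂μ) atTop
      (𝓝 ((μ {ω | y ω = B}).toReal⁻¹ • ∫ ω in {ω | y ω = B}, f ω ∂μ)) := by
  have hden := tendsto_integral_simil_smul hy hB (integrable_const (μ := μ) (1 : ℝ)) hγ
  simp only [smul_eq_mul, mul_one, setIntegral_const, Measure.real] at hden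
  exact (hden.inv₀ (ENNReal.toReal_ne_zero.mpr ⟨hpos, measure_ne_top _ _⟩)).smul
    (tendsto_integral_simil_smul hy hB hf hγ)

/-- Corollary of Proposition 3 (EOp direction): if the `s_γ`-SimFair violation vanishes
along a sequence `γ_n → ∞`, then the Equalized Opportunity violation is zero. -/
theorem stmt10 {Ω : Type*} [MeasurableSpace Ω]
    (P : Measure Ω) [IsProbabilityMeasure P]
    (K L : ℕ) (hK : 0 < K) (hL : 0 < L)
    (ytil : Ω → EuclideanSpace ℝ (Fin L)) (hmeas : Measurable ytil)
    (hbd : ∀ ω l, ytil ω l ∈ Set.Icc (0 : ℝ) 1)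
    (a : Ω → Fin K) (ha : Measurable a)
    (y : Ω → Finset (Fin L)) (hy : ∀ S : Finset (Fin L), MeasurableSet {ω | y ω = S})
    (yadv : Finset (Fin L)) (hyadv : yadv.Nonempty)
    (hpos : ∀ k : Fin K, 0 < P ({ω | a ω = k} ∩ {ω | y ω = yadv}))
    (γ : ℕ → ℝ) (hγ : Filter.Tendsto γ Filter.atTop Filter.atTop)
    (hzero : ∀ n, fairViolation P ytil a (fun ω => simil (γ n) (y ω) yadv) = 0) :
    ∀ k : Fin K,
      (P {ω | y ω = yadv}).toReal⁻¹ • (∫ ω in {ω | y ω = yadv}, ytil ω ∂P)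
        = (P ({ω | a ω = k} ∩ {ω | y ω = yadv})).toReal⁻¹ •
            (∫ ω in {ω | a ω = k} ∩ {ω | y ω = yadv}, ytil ω ∂P) := by
  intro k
  have hint : Integrable ytil P := by
    refine .of_bound hmeas.aestronglyMeasurable (√(L : ℝ)) (.of_forall fun ω => ?_)
    rw [EuclideanSpace.norm_eq]
    refine Real.sqrt_le_sqrt ?_
    calc ∑ l, ‖ytil ω l‖ ^ 2 ≤ ∑ _l : Fin L, (1 : ℝ) := by
          refine Finset.sum_le_sum fun l _ => pow_le_one₀ (norm_nonneg _) ?_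
          rw [Real.norm_of_nonneg (hbd ω l).1]
          exact (hbd ω l).2
      _ = L := by simp
  have hk : P.restrict {ω | a ω = k} {ω | y ω = yadv}
      = P ({ω | a ω = k} ∩ {ω | y ω = yadv}) := by
    rw [Measure.restrict_apply (hy yadv), Set.inter_comm]
  have hP := tendsto_inv_integral_simil_smul hy hyadv
    ((hpos k).trans_le (measure_mono Set.inter_subset_right)).ne' hint hγ
  have hPk := tendsto_inv_integral_simil_smul hy hyadv (hk ▸ (hpos k).ne')
    (hint.restrict (s := {ω | a ω = k})) hγ
  rw [Measure.restrict_restrict (hy yadv), Set.inter_comm, hk] at hPk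
  refine tendsto_nhds_unique hP (hPk.congr fun n => ?_)
  have hterm := (Finset.sum_eq_zero_iff_of_nonneg fun _ _ => norm_nonneg _).mp (hzero n) k
    (Finset.mem_univ k)
  exact (sub_eq_zero.mp (norm_eq_zero.mp hterm)).symm
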